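/- arXiv:2409.16989 — 9 statements merged into one kernel-verified Lean document; each statement's English description precedes it below -/
import Mathlib

section
/- Fix ρ ∈ (0,1), an integer n ≥ 1 and x, y ∈ ℤ. For every radius 0 < r < 1, the contour integral (1/(2πi))·∮_{|v|=r} ρ^n (1−ρ)^{x−y−n} (1+v)^{x−y−1} v^{−n} dv (integer powers of the complex number 1+v) equals \overline{Q}^{(n)}_ρ(x,y). Consequently: (a) \overline{Q}^{(n)}_ρ(x,y) = Q_ρ^n(x,y) whenever x − y ≥ 1; and (b) for each fixed x, the map y ↦ (1−ρ)^{y}·\overline{Q}^{(n)}_ρ(x,y) agrees on ℤ with a polynomial in y of degree at most n−1. -/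
/-- The geometric kernel `Q_ρ(x,y) = ρ(1−ρ)^{x−y−1}` for `x > y`, `0` otherwise. -/
noncomputable def Qker (ρ : ℝ) (x y : ℤ) : ℝ :=
  if y < x then ρ * (1 - ρ) ^ (x - y - 1) else 0

/-- The `n`-fold convolution power of `Q_ρ`. -/
noncomputable def Qpow (ρ : ℝ) : ℕ → ℤ → ℤ → ℝ
  | 0 => fun x y => if x = y then 1 else 0
  | 1 => Qker ρ
  | n + 2 => fun x y => ∑' z : ℤ, Qker ρ x z * Qpow ρ (n + 1) z y

/-- The polynomial extension `\overline{Q}^{(m)}_ρ(x,y)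
  = ρ^m (1−ρ)^{x−y−m} · (1/(m−1)!) ∏_{j=1}^{m−1}(x−y−j)`. -/
noncomputable def Qbar (ρ : ℝ) (m : ℕ) (x y : ℤ) : ℝ :=
  ρ ^ m * (1 - ρ) ^ (x - y - (m : ℤ)) *
    ((Nat.factorial (m - 1) : ℝ)⁻¹ * ∏ j ∈ Finset.Icc 1 (m - 1), ((x - y - (j : ℤ) : ℤ) : ℝ))

theorem Qpow_succ_eq_zero_of_le (ρ : ℝ) (m : ℕ) {x y : ℤ} (h : x ≤ y) :
    Qpow ρ (m + 1) x y = 0 := by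
  induction m generalizing x with
  | zero => simp [Qpow, Qker, h.not_gt]
  | succ m ih =>
    have hz (z : ℤ) : Qker ρ x z * Qpow ρ (m + 1) z y = 0 := by
      rcases le_or_gt x z with hxz | hzx
      · simp [Qker, hxz.not_gt]
      · rw [ih (hzx.le.trans h), mul_zero]
    simp [Qpow, hz]

theorem Nat.sum_range_choose_right (k m : ℕ) :
    ∑ i ∈ Finset.range k, i.choose m = k.choose (m + 1) := by
  induction k with
  | zero => simp
  | succ k ih => rw [Finset.sum_range_succ, ih, Nat.choose_succ_succ, add_comm]

theorem Qpow_succ_add_one_add {ρ : ℝ} (hρ : 1 - ρ ≠ 0) (m k : ℕ) (y : ℤ) :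
    Qpow ρ (m + 1) (y + 1 + k) y = ρ ^ (m + 1) * (1 - ρ) ^ ((k : ℤ) - m) * k.choose m := by
  induction m generalizing k with
  | zero =>
    have h : y < y + 1 + k := by omega
    simp [Qpow, Qker, h, show y + 1 + (k : ℤ) - y - 1 = k by ring]
  | succ m ih =>
    have hinj : Set.InjOn (fun i : ℕ => y + 1 + (i : ℤ)) (Finset.range k) := by
      intro a _ b _ hab
      simpa using hab
    simp only [Qpow]
    rw [tsum_eq_sum (s := (Finset.range k).image fun i : ℕ => y + 1 + (i : ℤ)),
      Finset.sum_image hinj, ← Nat.sum_range_choose_right, Nat.cast_sum, Finset.mul_sum]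
    · refine Finset.sum_congr rfl fun i hi => ?_
      have hik : y + 1 + (i : ℤ) < y + 1 + k := by
        have := Finset.mem_range.1 hi
        omega
      rw [ih, Qker, if_pos hik, show (k : ℤ) - ((m + 1 : ℕ) : ℤ)
        = (y + 1 + k - (y + 1 + i) - 1) + (i - m) by push_cast; ring, zpow_add₀ hρ]
      ring
    · intro z hz
      rcases le_or_gt (y + 1 + (k : ℤ)) z with hkz | hzk
      · simp [Qker, hkz.not_gt]
      · rw [Qpow_succ_eq_zero_of_le, mul_zero]
        by_contra! hyz
        refine hz (Finset.mem_image.2 ⟨(z - y - 1).toNat, Finset.mem_range.2 ?_, ?_⟩) <;> omega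

theorem prod_Icc_sub_eq_prod_range {R : Type*} [CommRing R] (a : R) (m : ℕ) :
    ∏ j ∈ Finset.Icc 1 m, (a - j) = ∏ i ∈ Finset.range m, (a - 1 - i) := by
  rw [← Finset.Ico_add_one_right_eq_Icc, Finset.prod_Ico_eq_prod_range, Nat.add_sub_cancel]
  refine Finset.prod_congr rfl fun i _ => ?_
  push_cast
  ring

theorem Qbar_eq_Qpow {ρ : ℝ} (hρ : 1 - ρ ≠ 0) (m : ℕ) {x y : ℤ} (h : 1 ≤ x - y) :
    Qbar ρ (m + 1) x y = Qpow ρ (m + 1) x y := by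
  obtain ⟨k, hk⟩ := Int.eq_ofNat_of_zero_le (sub_nonneg.2 h)
  obtain rfl : x = y + 1 + k := by omega
  have hprod : ∏ j ∈ Finset.Icc 1 m, (((y + 1 + k - y - (j : ℤ) : ℤ)) : ℝ)
      = m.factorial * k.choose m := by
    rw [← Nat.cast_mul, ← Nat.descFactorial_eq_factorial_mul_choose,
      ← descPochhammer_eval_eq_descFactorial ℝ, descPochhammer_eval_eq_prod_range]
    push_cast
    rw [prod_Icc_sub_eq_prod_range]
    refine Finset.prod_congr rfl fun j _ => ?_
    ring
  rw [Qpow_succ_add_one_add hρ, Qbar, Nat.add_sub_cancel, hprod,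
    inv_mul_cancel_left₀ (by positivity)]
  congr 3
  push_cast
  ring

theorem exists_polynomial_zpow_mul_Qbar {ρ : ℝ} (hρ : 1 - ρ ≠ 0) (n : ℕ) (x : ℤ) :
    ∃ p : Polynomial ℝ, p.natDegree ≤ n - 1 ∧
      ∀ z : ℤ, (1 - ρ) ^ z * Qbar ρ n x z = p.eval (z : ℝ) := by
  refine ⟨Polynomial.C (ρ ^ n * (1 - ρ) ^ (x - n) * ((n - 1).factorial : ℝ)⁻¹) *
    ∏ j ∈ Finset.Icc 1 (n - 1), (Polynomial.C ((x : ℝ) - j) - Polynomial.X), ?_, fun z => ?_⟩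
  · refine (Polynomial.natDegree_C_mul_le _ _).trans
      ((Polynomial.natDegree_prod_le _ _).trans ?_)
    refine (Finset.sum_le_card_nsmul _ _ 1 fun j _ => ?_).trans (by simp)
    compute_degree
  · have hprod : ∏ j ∈ Finset.Icc 1 (n - 1), ((x - z - (j : ℤ) : ℤ) : ℝ)
        = ∏ j ∈ Finset.Icc 1 (n - 1), ((x : ℝ) - j - z) :=
      Finset.prod_congr rfl fun j _ => by push_cast; ring
    rw [Polynomial.eval_mul, Polynomial.eval_C, Polynomial.eval_prod, Qbar, hprod,
      show x - (n : ℤ) = z + (x - z - n) by ring, zpow_add₀ hρ]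
    simp only [Polynomial.eval_sub, Polynomial.eval_C, Polynomial.eval_X]
    ring

theorem circleIntegral_one_add_zpow_mul_zpow {r : ℝ} (hr : 0 < r) (hr1 : r < 1) (a : ℤ) (m : ℕ) :
    (∮ v in C(0, r), (1 + v) ^ a * v ^ (-((m + 1 : ℕ) : ℤ)))
      = 2 * Real.pi * Complex.I / m.factorial * ∏ i ∈ Finset.range m, ((a : ℂ) - i) := by
  have hd : DifferentiableOn ℂ (fun v : ℂ => (1 + v) ^ a) (Metric.closedBall 0 r) := by
    intro v hv
    have hv1 : 1 + v ≠ 0 := by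
      intro h0
      rw [eq_neg_of_add_eq_zero_right h0] at hv
      simp at hv
      linarith
    exact ((differentiableAt_const _).add differentiableAt_id).zpow (Or.inl hv1)
      |>.differentiableWithinAt
  have h := hd.circleIntegral_one_div_sub_center_pow_smul hr m
  rw [iteratedDeriv_comp_const_add (n := m) (f := fun v : ℂ => v ^ a), iteratedDeriv_eq_iterate] at h
  simp only [iter_deriv_zpow, sub_zero, smul_eq_mul, add_zero, one_zpow, mul_one] at h
  rw [← h]
  congr 1
  ext v
  rw [zpow_neg, zpow_natCast, one_div, mul_comm]

theorem stmt1 (ρ : ℝ) (hρ : ρ ∈ Set.Ioo (0 : ℝ) 1) (n : ℕ) (hn : 1 ≤ n) (x y : ℤ) :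
    (∀ r : ℝ, 0 < r → r < 1 →
      (1 / (2 * (Real.pi : ℂ) * Complex.I)) *
          (∮ v in C(0, r),
            ((ρ : ℂ) ^ n * ((1 - ρ : ℝ) : ℂ) ^ (x - y - (n : ℤ)) * (1 + v) ^ (x - y - 1) *
              v ^ (-(n : ℤ))))
        = ((Qbar ρ n x y : ℝ) : ℂ)) ∧
    (1 ≤ x - y → Qbar ρ n x y = Qpow ρ n x y) ∧
    (∃ p : Polynomial ℝ, p.natDegree ≤ n - 1 ∧
      ∀ z : ℤ, (1 - ρ) ^ z * Qbar ρ n x z = p.eval (z : ℝ)) := by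
  obtain ⟨m, rfl⟩ := Nat.exists_eq_add_of_le' hn
  have hρ' : 1 - ρ ≠ 0 := (sub_pos.2 hρ.2).ne'
  refine ⟨fun r hr hr1 => ?_, Qbar_eq_Qpow hρ' m, exists_polynomial_zpow_mul_Qbar hρ' _ x⟩
  have hprod : ∏ j ∈ Finset.Icc 1 m, ((x - y - (j : ℤ) : ℤ) : ℂ)
      = ∏ i ∈ Finset.range m, (((x - y - 1 : ℤ) : ℂ) - i) := by
    push_cast
    exact prod_Icc_sub_eq_prod_range _ _
  simp only [mul_assoc _ _ (_ ^ (-(_ : ℤ))), circleIntegral.integral_const_mul]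
  rw [circleIntegral_one_add_zpow_mul_zpow hr hr1, ← hprod, Qbar, Nat.add_sub_cancel]
  push_cast
  field_simp
end

section
/- Fix ρ ∈ (0,1), t ∈ ℝ, integers n ≥ 1 and 0 ≤ k ≤ n−1, an integer X₀, and x ∈ ℤ. Then for every radius r > 0, (1/(2πi))·∮_{|w|=r} ((1−ρ)/ρ)^k (1−ρ)^{x−X₀} (1−w)^k w^{−(x+k+1−X₀)} e^{t(w−1)} dw = Σ_{y∈ℤ} R_{ρ,t}(x,y)·Q_ρ^{-k}(y, X₀), where the sum on the right has finitely many nonzero terms. -/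
/-- The kernel `R_{ρ,t}(x,y) = e^{−t}(1−ρ)^{x−y} t^{x−y}/(x−y)!` for `x ≥ y`, `0` otherwise. -/
noncomputable def Rker (ρ t : ℝ) (x y : ℤ) : ℝ :=
  if y ≤ x then
    Real.exp (-t) * (1 - ρ) ^ (x - y) * t ^ (x - y).toNat / (Nat.factorial (x - y).toNat)
  else 0

/-- The kernel `Q_ρ^{-1}(x,y) = (1/ρ)·1_{x=y−1} − ((1−ρ)/ρ)·1_{x=y}`. -/
noncomputable def Qinv (ρ : ℝ) (x y : ℤ) : ℝ :=
  (1 / ρ) * (if x = y - 1 then 1 else 0) - ((1 - ρ) / ρ) * (if x = y then 1 else 0)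

/-- `Q_ρ^{-k}`, the `k`-fold convolution power of `Q_ρ^{-1}`, with `Q_ρ^{-0}` the identity. -/
noncomputable def Qinvpow (ρ : ℝ) : ℕ → ℤ → ℤ → ℝ
  | 0 => fun x y => if x = y then 1 else 0
  | k + 1 => fun x y => ∑' z : ℤ, Qinv ρ x z * Qinvpow ρ k z y

open Complex Metric in
/-- The coefficient of `w ^ m` in `exp (t * (w - 1))`, extracted by a contour integral. -/
lemma circleIntegral_zpow_mul_exp (t : ℝ) (m : ℤ) (r : ℝ) (hr : 0 < r) :
    (∮ w in C(0, r), w ^ (-(m + 1)) * exp ((t : ℂ) * (w - 1))) =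
      (2 * Real.pi * I) *
        (if 0 ≤ m then exp (-(t : ℂ)) * (t : ℂ) ^ m.toNat / (m.toNat.factorial : ℂ) else 0) := by
  split_ifs with hm
  · lift m to ℕ using hm
    have hd : DiffContOnCl ℂ (fun w : ℂ => exp ((t : ℂ) * w)) (ball 0 r) :=
      Differentiable.diffContOnCl (by fun_prop)
    have h := hd.circleIntegral_one_div_sub_center_pow_smul hr m
    rw [iteratedDeriv_cexp_const_mul] at h
    have hfun : (fun w : ℂ => w ^ (-((m : ℤ) + 1)) * exp ((t : ℂ) * (w - 1))) =
        fun w => exp (-(t : ℂ)) * ((1 / (w - 0) ^ (m + 1)) • exp ((t : ℂ) * w)) := by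
      funext w
      have hp : w ^ (-((m : ℤ) + 1)) = 1 / w ^ (m + 1) := by
        rw [zpow_neg, one_div]
        norm_cast
      have he : exp ((t : ℂ) * (w - 1)) = exp (-(t : ℂ)) * exp ((t : ℂ) * w) := by
        rw [← exp_add]
        ring_nf
      rw [hp, he, sub_zero, smul_eq_mul]
      ring
    rw [hfun, circleIntegral.integral_const_mul, h]
    simp only [smul_eq_mul, mul_zero, exp_zero, Int.toNat_natCast]
    ring
  · obtain ⟨p, hp⟩ : ∃ p : ℕ, -(m + 1) = p := ⟨(-(m + 1)).toNat, by omega⟩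
    simp only [hp, zpow_natCast, mul_zero]
    exact DiffContOnCl.circleIntegral_eq_zero hr.le
      (Differentiable.diffContOnCl (by fun_prop))

lemma Qinvpow_succ_apply (ρ : ℝ) (k : ℕ) (x y : ℤ) :
    Qinvpow ρ (k + 1) x y =
      (1 / ρ) * Qinvpow ρ k (x + 1) y - ((1 - ρ) / ρ) * Qinvpow ρ k x y := by
  have hs : ∀ z ∉ ({x, x + 1} : Finset ℤ), Qinv ρ x z * Qinvpow ρ k z y = 0 := by
    intro z hz
    simp only [Finset.mem_insert, Finset.mem_singleton, not_or] at hz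
    rw [Qinv, if_neg (by omega), if_neg (by omega)]
    ring
  simp only [Qinvpow]
  rw [tsum_eq_sum hs, Finset.sum_pair (by omega)]
  simp only [Qinv]
  rw [if_neg (by omega), if_pos trivial, if_pos (by omega), if_neg (by omega)]
  ring

lemma Qinvpow_eq_zero_of_lt (ρ : ℝ) (k : ℕ) {x y : ℤ} (h : y < x) : Qinvpow ρ k x y = 0 := by
  induction k generalizing x with
  | zero => exact if_neg (by omega)
  | succ k ih => rw [Qinvpow_succ_apply, ih h, ih (by omega)]; ring

lemma Qinvpow_sub_natCast (ρ : ℝ) (k j : ℕ) (y : ℤ) :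
    Qinvpow ρ k (y - j) y = ρ⁻¹ ^ k * k.choose j * (-(1 - ρ)) ^ (k - j) := by
  induction k generalizing j with
  | zero =>
    cases j with
    | zero => simp [Qinvpow]
    | succ j =>
      simp only [Qinvpow]
      rw [if_neg (by omega)]
      simp
  | succ k ih =>
    rw [Qinvpow_succ_apply, ih]
    cases j with
    | zero =>
      rw [Qinvpow_eq_zero_of_lt ρ k (by omega)]
      simp only [Nat.choose_zero_right, Nat.sub_zero, pow_succ]
      ring
    | succ j =>
      have hshift : y - ((j + 1 : ℕ) : ℤ) + 1 = y - j := by push_cast; ring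
      rw [hshift, ih, Nat.choose_succ_succ', Nat.add_sub_add_right]
      rcases lt_or_ge j k with hj | hj
      · obtain ⟨d, rfl⟩ := Nat.exists_eq_add_of_lt hj
        rw [show j + d + 1 - j = d + 1 by omega, show j + d + 1 - (j + 1) = d by omega]
        push_cast
        ring
      · rw [Nat.choose_eq_zero_of_lt (show k < j + 1 by omega)]
        push_cast
        ring

lemma Rker_mul_Qinvpow_eq_zero (ρ t : ℝ) (k : ℕ) (x X₀ y : ℤ)
    (hy : y ∉ (Finset.range (k + 1)).image fun j : ℕ => X₀ - (j : ℤ)) :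
    Rker ρ t x y * Qinvpow ρ k y X₀ = 0 := by
  rcases lt_or_ge X₀ y with h | h
  · rw [Qinvpow_eq_zero_of_lt ρ k h, mul_zero]
  · obtain ⟨j, hj⟩ : ∃ j : ℕ, y = X₀ - j := ⟨(X₀ - y).toNat, by omega⟩
    have hjk : k < j := by
      by_contra hc
      exact hy (Finset.mem_image.2 ⟨j, Finset.mem_range.2 (by omega), hj.symm⟩)
    rw [hj, Qinvpow_sub_natCast, Nat.choose_eq_zero_of_lt hjk]
    simp

/-- The binomial expansion of `(1 - w) ^ k` times a power of `w`. -/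
lemma one_sub_pow_mul_zpow (k : ℕ) (m : ℤ) {w : ℂ} (hw : w ≠ 0) :
    (1 - w) ^ k * w ^ (-(m + k + 1)) =
      ∑ j ∈ Finset.range (k + 1), (-1) ^ (k - j) * (k.choose j : ℂ) * w ^ (-(m + j + 1)) := by
  rw [sub_eq_add_neg, add_pow, Finset.sum_mul]
  refine Finset.sum_congr rfl fun j hj => ?_
  have hjk : j ≤ k := Nat.lt_succ_iff.1 (Finset.mem_range.1 hj)
  have hz : w ^ (-(m + j + 1)) = w ^ (k - j) * w ^ (-(m + k + 1)) := by
    rw [← zpow_natCast, ← zpow_add₀ hw]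
    congr 1
    push_cast [hjk]
    ring
  rw [hz, one_pow, one_mul, neg_pow]
  ring

theorem stmt4 (ρ : ℝ) (hρ : ρ ∈ Set.Ioo (0 : ℝ) 1) (t : ℝ) (n k : ℕ) (hn : 1 ≤ n)
    (hk : k ≤ n - 1) (X₀ : ℤ) (x : ℤ) (r : ℝ) (hr : 0 < r) :
    {y : ℤ | Rker ρ t x y * Qinvpow ρ k y X₀ ≠ 0}.Finite ∧
    (1 / (2 * (Real.pi : ℂ) * Complex.I)) *
        (∮ w in C(0, r),
          ((((1 - ρ) / ρ : ℝ) : ℂ) ^ k * ((1 - ρ : ℝ) : ℂ) ^ (x - X₀) * (1 - w) ^ k *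
            w ^ (-(x + (k : ℤ) + 1 - X₀)) * Complex.exp ((t : ℂ) * (w - 1))))
      = ((∑' y : ℤ, Rker ρ t x y * Qinvpow ρ k y X₀ : ℝ) : ℂ) := by
  have hzero := Rker_mul_Qinvpow_eq_zero ρ t k x X₀
  refine ⟨(Finset.finite_toSet _).subset fun y hy => by_contra fun h => hy (hzero y h), ?_⟩
  have hq : (1 - ρ : ℝ) ≠ 0 := by linarith [hρ.2]
  set c : ℂ := (((1 - ρ) / ρ : ℝ) : ℂ) ^ k * ((1 - ρ : ℝ) : ℂ) ^ (x - X₀) with hc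
  have hexpand : (∮ w in C(0, r), c * (1 - w) ^ k * w ^ (-(x + (k : ℤ) + 1 - X₀)) *
        Complex.exp ((t : ℂ) * (w - 1))) =
      ∮ w in C(0, r), ∑ j ∈ Finset.range (k + 1), c * ((-1) ^ (k - j) * (k.choose j : ℂ)) *
        (w ^ (-((x - X₀ + j) + 1)) * Complex.exp ((t : ℂ) * (w - 1))) := by
    refine circleIntegral.integral_congr hr.le fun w hw => ?_
    have hw0 : w ≠ 0 := ne_zero_of_mem_sphere hr.ne' ⟨w, hw⟩
    rw [show -(x + (k : ℤ) + 1 - X₀) = -((x - X₀) + k + 1) by ring, mul_assoc c,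
      one_sub_pow_mul_zpow k _ hw0, Finset.mul_sum, Finset.sum_mul]
    exact Finset.sum_congr rfl fun j _ => by ring
  rw [hexpand, circleIntegral.integral_fun_sum, tsum_eq_sum hzero,
    Finset.sum_image fun a _ b _ h => by simpa using h, Complex.ofReal_sum, Finset.mul_sum]
  · refine Finset.sum_congr rfl fun j hj => ?_
    have hjk : j ≤ k := Nat.lt_succ_iff.1 (Finset.mem_range.1 hj)
    rw [circleIntegral.integral_const_mul, circleIntegral_zpow_mul_exp _ _ _ hr,
      Qinvpow_sub_natCast, Rker, show x - (X₀ - (j : ℤ)) = x - X₀ + j by ring]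
    have hpi := Complex.two_pi_I_ne_zero
    by_cases hx : 0 ≤ x - X₀ + j
    · rw [if_pos hx, if_pos (by omega)]
      have hpow : (1 - ρ) ^ k * (1 - ρ) ^ (x - X₀) =
          (1 - ρ) ^ (x - X₀ + j) * (1 - ρ) ^ (k - j) := by
        rw [← zpow_natCast, ← zpow_natCast, ← zpow_add₀ hq, ← zpow_add₀ hq]
        congr 1
        push_cast [hjk]
        ring
      have hcR : c = (((1 - ρ) ^ (x - X₀ + j) * (1 - ρ) ^ (k - j) * ρ⁻¹ ^ k : ℝ) : ℂ) := by
        rw [hc, ← hpow]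
        push_cast
        rw [div_eq_mul_inv, mul_pow]
        ring
      rw [hcR, neg_pow (1 - ρ)]
      push_cast
      field_simp
    · rw [if_neg hx, if_neg (by omega)]
      simp
  · intro j _
    refine ContinuousOn.circleIntegrable hr.le (ContinuousOn.mul continuousOn_const
      (ContinuousOn.mul (fun w hw => ?_) (by fun_prop)))
    have hw0 : w ≠ 0 := ne_zero_of_mem_sphere hr.ne' ⟨w, hw⟩
    exact (continuousAt_zpow₀ w _ (Or.inl hw0)).continuousWithinAt
end

section
/- Fix ρ ∈ (0,1), integers n ≥ 1 and 0 ≤ k < n, and a strictly decreasing map X₀ : {1,…,n} → ℤ. If h and h' both solve the backwards-heat IBVP for (ρ,n,k,X₀), then h = h'; i.e. the solution of the backwards-heat IBVP is unique. -/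
/-- `h` solves the backwards-heat initial–boundary value problem for `(ρ, n, k, X₀)`:
(i) `(1/ρ)h(l,z−1) − ((1−ρ)/ρ)h(l,z) = h(l+1,z)` for `l < k`;
(ii) `h(k,z) = ρ(1−ρ)^{X₀(n−k)−z−1}`;
(iii) `h(l, X₀(n−l)) = 0` for `l < k`. -/
def SolvesIBVP (ρ : ℝ) (n k : ℕ) (X₀ : ℕ → ℤ) (h : ℕ → ℤ → ℝ) : Prop :=
  (∀ l, l < k → ∀ z : ℤ, (1 / ρ) * h l (z - 1) - ((1 - ρ) / ρ) * h l z = h (l + 1) z) ∧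
  (∀ z : ℤ, h k z = ρ * (1 - ρ) ^ (X₀ (n - k) - z - 1)) ∧
  (∀ l, l < k → h l (X₀ (n - l)) = 0)

/-- A first-order linear recurrence over `ℤ` with nonzero coefficients has at most one solution
with a prescribed value at a given point. -/
theorem eq_of_int_recurrence {K : Type*} [Field K] {a b : K} (ha : a ≠ 0) (hb : b ≠ 0)
    {f g : ℤ → K} (hfg : ∀ z, a * f (z - 1) - b * f z = a * g (z - 1) - b * g z)
    {m : ℤ} (hm : f m = g m) (z : ℤ) : f z = g z := by
  induction z using Int.inductionOn' (b := m) with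
  | zero => exact hm
  | succ j _ ih =>
    have e := hfg (j + 1)
    rw [add_sub_cancel_right, ih] at e
    exact mul_left_cancel₀ hb (sub_right_injective e)
  | pred j _ ih =>
    have e := hfg j
    rw [ih] at e
    exact mul_left_cancel₀ ha (sub_left_injective e)

theorem stmt6 (ρ : ℝ) (hρ : ρ ∈ Set.Ioo (0 : ℝ) 1) (n k : ℕ) (hn : 1 ≤ n) (hk : k < n)
    (X₀ : ℕ → ℤ) (hX : ∀ i j : ℕ, 1 ≤ i → i < j → j ≤ n → X₀ j < X₀ i)
    (h h' : ℕ → ℤ → ℝ)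
    (hh : SolvesIBVP ρ n k X₀ h) (hh' : SolvesIBVP ρ n k X₀ h') :
    ∀ l, l ≤ k → ∀ z : ℤ, h l z = h' l z := by
  obtain ⟨h_rec, h_init, h_bdry⟩ := hh
  obtain ⟨h_rec', h_init', h_bdry'⟩ := hh'
  have h_inv : 1 / ρ ≠ 0 := one_div_ne_zero hρ.1.ne'
  have h_coeff : (1 - ρ) / ρ ≠ 0 := div_ne_zero (sub_pos.2 hρ.2).ne' hρ.1.ne'
  intro l hl
  induction hl using Nat.decreasingInduction with
  | self => exact fun z => (h_init z).trans (h_init' z).symm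
  | of_succ l hl ih =>
    refine eq_of_int_recurrence h_inv h_coeff (fun z => ?_)
      ((h_bdry l hl).trans (h_bdry' l hl).symm)
    rw [h_rec l hl, h_rec' l hl, ih]
end

section
/- Fix ρ ∈ (0,1), integers n ≥ 1 and 0 ≤ k < n, a strictly decreasing map X₀ : {1,…,n} → ℤ, and suppose h solves the backwards-heat IBVP for (ρ,n,k,X₀). Then for every 0 ≤ l ≤ k there exists a polynomial p_l with real coefficients of degree at most k−l such that h(l,z) = (1−ρ)^{−z}·p_l(z) for all z ∈ ℤ. -/
open Polynomial in
/-- A polynomial of degree at most `d` is the backward difference of one of degree at most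
`d + 1`. -/
lemma exists_polynomial_backward_difference (q : ℝ[X]) (d : ℕ) (hq : q.natDegree ≤ d) :
    ∃ P : ℝ[X], P.natDegree ≤ d + 1 ∧
      ∀ z : ℤ, P.eval (z : ℝ) - P.eval ((z - 1 : ℤ) : ℝ) = q.eval (z : ℝ) := by
  let B : ℕ → ℝ[X] := fun i => ((Polynomial.bernoulli (i + 1)).map (algebraMap ℚ ℝ)).comp (X + 1)
  have hB (i : ℕ) : (B i).natDegree ≤ i + 1 := by
    refine natDegree_comp_le.trans ?_
    have h1 : (X + 1 : ℝ[X]).natDegree = 1 := natDegree_X_add_C 1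
    rw [h1, mul_one]
    refine natDegree_map_le.trans ?_
    rw [Polynomial.bernoulli]
    refine natDegree_sum_le_of_forall_le _ _ fun j _ => ?_
    exact (natDegree_monomial_le _).trans (by omega)
  have hBz (i : ℕ) (z : ℤ) :
      (B i).eval (z : ℝ) - (B i).eval ((z - 1 : ℤ) : ℝ) = (i + 1) * (z : ℝ) ^ i := by
    have e := congrArg (algebraMap ℚ ℝ) (bernoulli_eval_one_add (i + 1) (z : ℚ))
    have c (w : ℚ) : ((Polynomial.bernoulli (i + 1)).map (algebraMap ℚ ℝ)).eval (w : ℝ)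
        = algebraMap ℚ ℝ ((Polynomial.bernoulli (i + 1)).eval w) :=
      eval_map_apply (algebraMap ℚ ℝ) w
    have h1 : (B i).eval (z : ℝ) = algebraMap ℚ ℝ ((Polynomial.bernoulli (i + 1)).eval (1 + z : ℚ)) := by
      rw [← c]; simp [B, add_comm]
    have h2 : (B i).eval ((z - 1 : ℤ) : ℝ) = algebraMap ℚ ℝ ((Polynomial.bernoulli (i + 1)).eval (z : ℚ)) := by
      rw [← c]; simp [B]
    rw [h1, h2, e]
    simp
  refine ⟨∑ i ∈ Finset.range (d + 1), C (q.coeff i / (i + 1)) * B i, ?_, fun z => ?_⟩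
  · refine natDegree_sum_le_of_forall_le _ _ fun i hi => ?_
    have := Finset.mem_range.mp hi
    exact (natDegree_C_mul_le _ _).trans ((hB i).trans (by omega))
  · rw [eval_eq_sum_range' (Nat.lt_succ_of_le hq), eval_finsetSum, eval_finsetSum,
      ← Finset.sum_sub_distrib]
    refine Finset.sum_congr rfl fun i _ => ?_
    rw [eval_mul, eval_mul, eval_C, eval_C, ← mul_sub, hBz]
    have : (i : ℝ) + 1 ≠ 0 := by positivity
    field_simp

lemma eq_apply_zero_of_forall_eq_sub_one {α : Type*} (f : ℤ → α) (hf : ∀ z, f z = f (z - 1))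
    (z : ℤ) : f z = f 0 := by
  induction z with
  | zero => rfl
  | succ i ih => rw [hf, add_sub_cancel_right, ih]
  | pred i ih => rw [← hf, ih]

theorem stmt7 (ρ : ℝ) (hρ : ρ ∈ Set.Ioo (0 : ℝ) 1) (n k : ℕ) (hn : 1 ≤ n) (hk : k < n)
    (X₀ : ℕ → ℤ) (hX : ∀ i j : ℕ, 1 ≤ i → i < j → j ≤ n → X₀ j < X₀ i)
    (h : ℕ → ℤ → ℝ) (hh : SolvesIBVP ρ n k X₀ h) :
    ∀ l, l ≤ k → ∃ p : Polynomial ℝ, p.natDegree ≤ k - l ∧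
      ∀ z : ℤ, h l z = (1 - ρ) ^ (-z) * p.eval (z : ℝ) := by
  obtain ⟨hstep, hend, -⟩ := hh
  have hρ0 : ρ ≠ 0 := hρ.1.ne'
  have ha : (1 - ρ) ≠ 0 := (sub_pos.mpr hρ.2).ne'
  intro l hl
  induction hl using Nat.decreasingInduction with
  | self =>
    refine ⟨Polynomial.C (ρ * (1 - ρ) ^ (X₀ (n - k) - 1)),
      (Polynomial.natDegree_C _).trans_le (Nat.zero_le _),
      fun z => ?_⟩
    rw [hend, Polynomial.eval_C, show X₀ (n - k) - z - 1 = -z + (X₀ (n - k) - 1) by ring,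
      zpow_add₀ ha]
    ring
  | of_succ l hl ih =>
    obtain ⟨q, hq, hqz⟩ := ih
    obtain ⟨P, hP, hPz⟩ := exists_polynomial_backward_difference q _ hq
    let f : ℤ → ℝ := fun z => (1 - ρ) ^ z * h l z + ρ / (1 - ρ) * P.eval (z : ℝ)
    have hf (z : ℤ) : f z = f (z - 1) := by
      have e := hstep l hl z
      rw [hqz, ← hPz, zpow_neg] at e
      have hz : (1 - ρ) ^ z ≠ 0 := zpow_ne_zero _ ha
      simp only [f, zpow_sub_one₀ ha]
      field_simp at e ⊢
      linear_combination -e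
    refine ⟨Polynomial.C (f 0) - Polynomial.C (ρ / (1 - ρ)) * P, ?_, fun z => ?_⟩
    · refine (Polynomial.natDegree_sub_le _ _).trans (max_le (by simp) ?_)
      exact (Polynomial.natDegree_C_mul_le _ _).trans (hP.trans (by omega))
    · have hz : (1 - ρ) ^ z ≠ 0 := zpow_ne_zero _ ha
      rw [← eq_apply_zero_of_forall_eq_sub_one f hf z, zpow_neg]
      simp only [f, Polynomial.eval_sub, Polynomial.eval_mul, Polynomial.eval_C]
      field_simp
      ring
end

section
/- Fix ρ ∈ (0,1), t > 0, integers n ≥ 1 and 0 ≤ k ≤ n−1, a strictly decreasing map X₀ : {1,…,n} → ℤ, and let h_k solve the backwards-heat IBVP for (ρ,n,k,X₀). Then there exists a polynomial p with real coefficients of degree at most k (in particular at most n−1) such that Φ^n_{ρ,k}(x) = (1−ρ)^{−x}·p(x) for all x ∈ ℤ, where Φ^n_{ρ,k}(z) := Σ_{y∈ℤ} ((1−ρ)/ρ) h_k(0,y) R_{ρ,t}^{-1}(y,z) (an absolutely convergent sum). -/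
/-- `R_{ρ,t}^{-1}(x,y) = e^{t}(1−ρ)^{x−y}(−t)^{x−y}/(x−y)!` for `x ≥ y`, `0` otherwise. -/
noncomputable def Rinv (ρ t : ℝ) (x y : ℤ) : ℝ :=
  if y ≤ x then
    Real.exp t * (1 - ρ) ^ (x - y) * (-t) ^ (x - y).toNat / (Nat.factorial (x - y).toNat)
  else 0

/-- `Φ^n_{ρ,k}(z) := Σ_y ((1−ρ)/ρ) h_k(0,y) R_{ρ,t}^{-1}(y,z)`. -/
noncomputable def Phi (ρ t : ℝ) (hk0 : ℤ → ℝ) (z : ℤ) : ℝ :=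
  ∑' y : ℤ, ((1 - ρ) / ρ) * hk0 y * Rinv ρ t y z

open Polynomial in
/-- Every real polynomial is the forward difference of a polynomial of degree one more. -/
theorem exists_polynomial_forward_difference (q : ℝ[X]) :
    ∃ Q : ℝ[X], Q.natDegree ≤ q.natDegree + 1 ∧
      ∀ x : ℝ, Q.eval (x + 1) - Q.eval x = q.eval x := by
  refine ⟨∑ i ∈ Finset.range (q.natDegree + 1),
    C (q.coeff i / (i + 1)) * (Polynomial.bernoulli (i + 1)).map (algebraMap ℚ ℝ), ?_, ?_⟩
  · refine natDegree_sum_le_of_forall_le _ _ fun i hi => ?_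
    have hB : (Polynomial.bernoulli (i + 1)).natDegree ≤ i + 1 := by
      refine natDegree_le_iff_coeff_eq_zero.2 fun j hj => ?_
      rw [coeff_bernoulli, if_neg (by omega)]
    have hi' := Finset.mem_range.1 hi
    exact (natDegree_C_mul_le _ _).trans (natDegree_map_le.trans (hB.trans (by omega)))
  · intro x
    rw [eval_finsetSum, eval_finsetSum, ← Finset.sum_sub_distrib, eval_eq_sum_range]
    refine Finset.sum_congr rfl fun i _ => ?_
    have hB := congrArg (fun p => (p.map (algebraMap ℚ ℝ)).eval x) (bernoulli_comp_one_add_X (i + 1))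
    simp only [Polynomial.map_comp, Polynomial.map_add, Polynomial.map_one, map_X, eval_comp,
      eval_add, eval_one, eval_X, add_comm (1 : ℝ) x] at hB
    rw [eval_mul, eval_mul, eval_C, eval_C, ← mul_sub, hB]
    have hne : (i : ℝ) + 1 ≠ 0 := by positivity
    simp
    field_simp

open Polynomial in
/-- A function on `ℤ` whose forward difference is polynomial is itself polynomial. -/
theorem exists_polynomial_of_forward_difference (f : ℤ → ℝ) (q : ℝ[X])
    (hf : ∀ z : ℤ, f (z + 1) - f z = q.eval (z : ℝ)) :
    ∃ Q : ℝ[X], Q.natDegree ≤ q.natDegree + 1 ∧ ∀ z : ℤ, f z = Q.eval (z : ℝ) := by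
  obtain ⟨Q, hQ, hd⟩ := exists_polynomial_forward_difference q
  refine ⟨Q + C (f 0 - Q.eval 0), ?_, fun z => ?_⟩
  · exact natDegree_add_C.trans_le hQ
  · rw [eval_add, eval_C]
    induction z using Int.induction_on with
    | zero => simp
    | succ i ih =>
      have h1 := hf i
      have h2 := hd ((i : ℤ) : ℝ)
      push_cast at *
      linarith
    | pred i ih =>
      have h1 := hf (-i - 1)
      have h2 := hd ((-i - 1 : ℤ) : ℝ)
      push_cast at *
      simp only [sub_add_cancel] at h1 h2
      linarith

theorem summable_pow_mul_pow_div_factorial (i : ℕ) (s : ℝ) :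
    Summable fun j : ℕ => (j : ℝ) ^ i * (s ^ j / (Nat.factorial j : ℝ)) := by
  refine Summable.of_norm_bounded
    ((Real.summable_pow_div_factorial (Real.exp 1 * |s|)).mul_left (Nat.factorial i : ℝ)) ?_
  intro j
  have hj : (j : ℝ) ^ i ≤ Nat.factorial i * Real.exp 1 ^ j := by
    have h := Real.pow_div_factorial_le_exp (x := (j : ℝ)) (by positivity) i
    rw [div_le_iff₀ (by positivity)] at h
    rw [← Real.exp_nat_mul, mul_one]
    linarith
  rw [Real.norm_eq_abs, abs_mul, abs_div, abs_pow, abs_pow, Nat.abs_cast, Nat.abs_cast, mul_pow]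
  calc _ ≤ (Nat.factorial i * Real.exp 1 ^ j) * (|s| ^ j / (Nat.factorial j : ℝ)) := by gcongr
    _ = _ := by ring

open Polynomial in
/-- Averaging the translates of a polynomial against the exponential series gives a polynomial
of no larger degree. -/
theorem exists_polynomial_hasSum_translates (q : ℝ[X]) (s : ℝ) :
    ∃ p : ℝ[X], p.natDegree ≤ q.natDegree ∧ ∀ x : ℝ,
      HasSum (fun j : ℕ => q.eval (x + j) * (s ^ j / (Nat.factorial j : ℝ))) (p.eval x) := by
  refine ⟨∑ i ∈ Finset.range (q.natDegree + 1),
    C (∑' j : ℕ, (j : ℝ) ^ i * (s ^ j / (Nat.factorial j : ℝ))) * hasseDeriv i q, ?_, ?_⟩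
  · exact natDegree_sum_le_of_forall_le _ _ fun i _ => (natDegree_C_mul_le _ _).trans
      ((natDegree_hasseDeriv_le q i).trans (Nat.sub_le _ _))
  · intro x
    rw [eval_finsetSum]
    have hsum := hasSum_sum (s := Finset.range (q.natDegree + 1)) fun i _ =>
      (summable_pow_mul_pow_div_factorial i s).hasSum.mul_right ((hasseDeriv i q).eval x)
    simp only [eval_mul, eval_C]
    refine (congrArg (HasSum · _) (funext fun j => ?_)).mpr hsum
    rw [add_comm, ← taylor_eval, eval_eq_sum_range, natDegree_taylor, Finset.sum_mul]
    refine Finset.sum_congr rfl fun i _ => ?_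
    rw [taylor_coeff]
    ring

open Polynomial in
/-- A solution of the backwards-heat problem is, at each level, a polynomial times a geometric
factor. -/
theorem SolvesIBVP.exists_polynomial {ρ : ℝ} (hρ : ρ ∈ Set.Ioo (0 : ℝ) 1) {n k : ℕ} {X₀ : ℕ → ℤ}
    {h : ℕ → ℤ → ℝ} (hh : SolvesIBVP ρ n k X₀ h) (m l : ℕ) (hlm : l + m = k) :
    ∃ q : ℝ[X], q.natDegree ≤ m ∧ ∀ z : ℤ, h l z = (1 - ρ) ^ (-z) * q.eval (z : ℝ) := by
  have hρ0 : ρ ≠ 0 := hρ.1.ne'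
  have hρ1 : 1 - ρ ≠ 0 := (sub_pos.2 hρ.2).ne'
  induction m generalizing l with
  | zero =>
    obtain rfl : l = k := by omega
    refine ⟨C (ρ * (1 - ρ) ^ (X₀ (n - l) - 1)), (natDegree_C _).le, fun z => ?_⟩
    rw [hh.2.1, eval_C, show X₀ (n - l) - z - 1 = -z + (X₀ (n - l) - 1) by ring, zpow_add₀ hρ1]
    ring
  | succ m ih =>
    obtain ⟨q, hq, hqe⟩ := ih (l + 1) (by omega)
    obtain ⟨Q, hQ, hQe⟩ := exists_polynomial_of_forward_difference
      (fun z => (1 - ρ) ^ z * h l z) (C (-(ρ / (1 - ρ))) * taylor 1 q) fun z => by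
        have h1 := hh.1 l (by omega) (z + 1)
        rw [hqe, add_sub_cancel_right, zpow_neg, zpow_add_one₀ hρ1] at h1
        rw [eval_mul, eval_C, taylor_eval, zpow_add_one₀ hρ1]
        have hz : (1 - ρ) ^ z ≠ 0 := zpow_ne_zero _ hρ1
        push_cast at h1
        field_simp at h1 ⊢
        linear_combination -h1
    refine ⟨Q, hQ.trans (Nat.succ_le_succ ((natDegree_C_mul_le _ _).trans ?_)), fun z => ?_⟩
    · rwa [natDegree_taylor]
    · rw [← hQe, ← mul_assoc, ← zpow_add₀ hρ1, neg_add_cancel, zpow_zero, one_mul]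

theorem stmt9 (ρ : ℝ) (hρ : ρ ∈ Set.Ioo (0 : ℝ) 1) (t : ℝ) (ht : 0 < t)
    (n k : ℕ) (hn : 1 ≤ n) (hk : k ≤ n - 1)
    (X₀ : ℕ → ℤ) (hX : ∀ i j : ℕ, 1 ≤ i → i < j → j ≤ n → X₀ j < X₀ i)
    (h : ℕ → ℤ → ℝ) (hh : SolvesIBVP ρ n k X₀ h) :
    (∀ z : ℤ, Summable (fun y : ℤ => |((1 - ρ) / ρ) * h 0 y * Rinv ρ t y z|)) ∧
    ∃ p : Polynomial ℝ, p.natDegree ≤ k ∧ p.natDegree ≤ n - 1 ∧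
      ∀ x : ℤ, Phi ρ t (h 0) x = (1 - ρ) ^ (-x) * p.eval (x : ℝ) := by
  have hρ1 : 1 - ρ ≠ 0 := (sub_pos.2 hρ.2).ne'
  obtain ⟨q, hq, hqe⟩ := hh.exists_polynomial hρ k 0 (zero_add k)
  obtain ⟨p, hp, hps⟩ := exists_polynomial_hasSum_translates q (-t)
  have hsum (x : ℤ) : HasSum (fun y : ℤ => ((1 - ρ) / ρ) * h 0 y * Rinv ρ t y x)
      ((1 - ρ) ^ (-x) * ((Polynomial.C ((1 - ρ) / ρ * Real.exp t)) * p).eval (x : ℝ)) := by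
    have hinj : Function.Injective fun j : ℕ => x + (j : ℤ) := fun a b hab => by
      simpa using hab
    rw [← hinj.hasSum_iff]
    · rw [Polynomial.eval_mul, Polynomial.eval_C, ← mul_assoc]
      refine (congrArg (HasSum · _) (funext fun j => ?_)).mpr
        ((hps x).mul_left ((1 - ρ) ^ (-x) * ((1 - ρ) / ρ * Real.exp t)))
      simp only [Function.comp_apply, Rinv]
      rw [if_pos (by omega), hqe, add_sub_cancel_left, Int.toNat_natCast, neg_add,
        zpow_add₀ hρ1, zpow_neg _ (j : ℤ)]
      have hj : (1 - ρ) ^ (j : ℤ) ≠ 0 := zpow_ne_zero _ hρ1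
      push_cast
      field_simp
    · intro y hy
      have hxy : ¬ x ≤ y := fun hle => hy ⟨(y - x).toNat, by simp only; omega⟩
      rw [Rinv, if_neg hxy, mul_zero]
  have hdeg : (Polynomial.C ((1 - ρ) / ρ * Real.exp t) * p).natDegree ≤ k :=
    (Polynomial.natDegree_C_mul_le _ _).trans (hp.trans hq)
  exact ⟨fun z => (hsum z).summable.abs,
    _, hdeg, hdeg.trans hk, fun x => (hsum x).tsum_eq⟩
end

section
/- Fix ρ ∈ (0,1), integers n ≥ 1 and 0 ≤ l ≤ k < n, a strictly decreasing map X₀ : {1,…,n} → ℤ, and let h solve the backwards-heat IBVP for (ρ,n,k,X₀). Let μ be the product probability measure ⊗_{i=l}^{n−1} ν_ρ on ℕ^{\{l,…,n−1\}}, where ν_ρ is the geometric distribution with ν_ρ({j}) = ρ(1−ρ)^j for j ∈ ℕ. For ω in this product space and a starting point z ∈ ℤ, define the random walk B_m(ω) := z + Σ_{i=l}^{m} (ω_i + 1) for l ≤ m ≤ n−1 (so the increments are i.i.d. with P(increment = j) = ρ(1−ρ)^{j−1} for j ≥ 1), and let τ(ω) be the smallest m ∈ {l,…,n−1} with B_m(ω)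 > X₀(n−m), with τ(ω) = n if no such m exists. Then for every z ≤ X₀(n−l): μ({ω : τ(ω) = k}) = ((1−ρ)/ρ)·h(l, z). -/
open MeasureTheory

/-- The geometric distribution `ν_ρ` on `ℕ` with `ν_ρ({j}) = ρ(1−ρ)^j`. -/
noncomputable def geomMeasure (ρ : ℝ) : Measure ℕ :=
  Measure.sum fun j : ℕ => (ENNReal.ofReal (ρ * (1 - ρ) ^ j)) • Measure.dirac j

/-- The rightward random walk `B_m(ω) = z + Σ_{i=l}^{m} (ω_i + 1)` for `l ≤ m ≤ n−1`,
where the coordinate of index `i ∈ {l,…,n−1}` is `ω ⟨i−l⟩ : ℕ`. -/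
noncomputable def walkB (l n : ℕ) (z : ℤ) (ω : Fin (n - l) → ℕ) (m : ℕ) : ℤ :=
  z + ∑ i ∈ Finset.filter (fun i : Fin (n - l) => l + (i : ℕ) ≤ m) Finset.univ, ((ω i : ℤ) + 1)

/-- The hitting time `τ(ω)`: the smallest `m ∈ {l,…,n−1}` with `B_m(ω) > X₀(n−m)`,
and `n` if there is no such `m`. -/
noncomputable def walkTau (l n : ℕ) (X₀ : ℕ → ℤ) (z : ℤ) (ω : Fin (n - l) → ℕ) : ℕ :=
  sInf ({m : ℕ | l ≤ m ∧ m ≤ n - 1 ∧ X₀ (n - m) < walkB l n z ω m} ∪ {n})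

/-- The walk started at `z` whose `i`-th increment is `ω i + 1`, after `m + 1` steps. -/
def geomWalk {N : ℕ} (z : ℤ) (ω : Fin N → ℕ) (m : ℕ) : ℤ :=
  z + ∑ i : Fin N, if (i : ℕ) ≤ m then (ω i : ℤ) + 1 else 0

/-- The event that `geomWalk` first exceeds the barrier `Y` at time `d`. -/
def firstPassage (N : ℕ) (Y : ℕ → ℤ) (z : ℤ) (d : ℕ) : Set (Fin N → ℕ) :=
  {ω | (∀ m < d, geomWalk z ω m ≤ Y m) ∧ Y d < geomWalk z ω d}

lemma geomWalk_cons_zero {N : ℕ} (z : ℤ) (a : ℕ) (ω : Fin N → ℕ) :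
    geomWalk z (Fin.cons a ω : Fin (N + 1) → ℕ) 0 = z + a + 1 := by
  simp [geomWalk, add_assoc]

lemma geomWalk_cons_succ {N : ℕ} (z : ℤ) (a : ℕ) (ω : Fin N → ℕ) (m : ℕ) :
    geomWalk z (Fin.cons a ω : Fin (N + 1) → ℕ) (m + 1) = geomWalk (z + a + 1) ω m := by
  simp [geomWalk, Fin.sum_univ_succ, add_assoc]

lemma cons_mem_firstPassage_zero {N : ℕ} (Y : ℕ → ℤ) (z : ℤ) (a : ℕ) (ω : Fin N → ℕ) :
    (Fin.cons a ω : Fin (N + 1) → ℕ) ∈ firstPassage (N + 1) Y z 0 ↔ Y 0 < z + a + 1 := by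
  simp [firstPassage, geomWalk_cons_zero]

lemma cons_mem_firstPassage_succ {N : ℕ} (Y : ℕ → ℤ) (z : ℤ) (d a : ℕ) (ω : Fin N → ℕ) :
    (Fin.cons a ω : Fin (N + 1) → ℕ) ∈ firstPassage (N + 1) Y z (d + 1) ↔
      z + a + 1 ≤ Y 0 ∧ ω ∈ firstPassage N (fun m => Y (m + 1)) (z + a + 1) d := by
  simp only [firstPassage, Set.mem_ofPred_eq, geomWalk_cons_succ]
  constructor
  · rintro ⟨h1, h2⟩
    refine ⟨?_, fun m hm => ?_, h2⟩
    · simpa only [geomWalk_cons_zero] using h1 0 (by omega)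
    · simpa only [geomWalk_cons_succ] using h1 (m + 1) (by omega)
  · rintro ⟨h0, h1, h2⟩
    refine ⟨fun m hm => ?_, h2⟩
    cases m with
    | zero => simpa only [geomWalk_cons_zero] using h0
    | succ m => simpa only [geomWalk_cons_succ] using h1 m (by omega)

lemma lintegral_geomMeasure (ρ : ℝ) (f : ℕ → ENNReal) :
    ∫⁻ a, f a ∂geomMeasure ρ = ∑' j : ℕ, ENNReal.ofReal (ρ * (1 - ρ) ^ j) * f j := by
  simp [geomMeasure, lintegral_sum_measure, lintegral_smul_measure]

lemma tsum_ofReal_geometric_tail {ρ : ℝ} (hρ : ρ ∈ Set.Ioo (0 : ℝ) 1) (M : ℕ) :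
    ∑' j : ℕ, ENNReal.ofReal (ρ * (1 - ρ) ^ (j + M)) = ENNReal.ofReal ((1 - ρ) ^ M) := by
  obtain ⟨h0, h1⟩ := hρ
  have hs : HasSum (fun j : ℕ => ρ * (1 - ρ) ^ (j + M)) ((1 - ρ) ^ M) := by
    have := (hasSum_geometric_of_lt_one (r := 1 - ρ) (by linarith) (by linarith)).mul_left
      (ρ * (1 - ρ) ^ M)
    have h0' : ρ ≠ 0 := h0.ne'
    rw [sub_sub_cancel, mul_right_comm, mul_inv_cancel₀ h0', one_mul] at this
    exact (funext fun j => by ring :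
      (fun j : ℕ => ρ * (1 - ρ) ^ (j + M)) = fun j => ρ * (1 - ρ) ^ M * (1 - ρ) ^ j) ▸ this
  rw [← ENNReal.ofReal_tsum_of_nonneg _ hs.summable, hs.tsum_eq]
  exact fun j => mul_nonneg h0.le (pow_nonneg (by linarith) _)

lemma isProbabilityMeasure_geomMeasure {ρ : ℝ} (hρ : ρ ∈ Set.Ioo (0 : ℝ) 1) :
    IsProbabilityMeasure (geomMeasure ρ) := by
  constructor
  rw [← lintegral_one, lintegral_geomMeasure]
  simpa using tsum_ofReal_geometric_tail hρ 0

lemma pi_geomMeasure_succ {ρ : ℝ} (hρ : ρ ∈ Set.Ioo (0 : ℝ) 1) (N : ℕ)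
    (S : Set (Fin (N + 1) → ℕ)) :
    (Measure.pi fun _ : Fin (N + 1) => geomMeasure ρ) S =
      ∑' j : ℕ, ENNReal.ofReal (ρ * (1 - ρ) ^ j) *
        (Measure.pi fun _ : Fin N => geomMeasure ρ) {ω | (Fin.cons j ω : Fin (N + 1) → ℕ) ∈ S} := by
  have := isProbabilityMeasure_geomMeasure hρ
  have hp := (measurePreserving_piFinSuccAbove (fun _ : Fin (N + 1) => geomMeasure ρ) 0).symm
  rw [← hp.measure_preimage (Set.to_countable S).measurableSet.nullMeasurableSet,
    Measure.prod_apply (Set.to_countable _).measurableSet, lintegral_geomMeasure]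
  refine tsum_congr fun j => ?_
  congr 2
  ext ω
  simp [MeasurableEquiv.piFinSuccAbove, Fin.consEquiv]

/-- The variation-of-constants formula for the backward recursion, started at its zero. -/
lemma sum_geometric_eq_of_recursion {ρ : ℝ} {u v : ℤ → ℝ} {y : ℤ} (hy : u y = 0)
    (hrec : ∀ z, u (z - 1) = (1 - ρ) * u z + ρ * v z) (M : ℕ) :
    u (y - M) = ∑ j ∈ Finset.range M, ρ * (1 - ρ) ^ j * v (y - M + j + 1) := by
  induction M with
  | zero => simpa using hy
  | succ M ih =>
    rw [Finset.sum_range_succ']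
    have e : y - ((M + 1 : ℕ) : ℤ) = y - M - 1 := by push_cast; ring
    rw [e, hrec, ih, Finset.mul_sum]
    congr 1
    · refine Finset.sum_congr rfl fun j _ => ?_
      have : y - (M : ℤ) - 1 + ((j + 1 : ℕ) : ℤ) + 1 = y - M + j + 1 := by push_cast; ring
      rw [this]; ring
    · simp

theorem pi_geomMeasure_firstPassage {ρ : ℝ} (hρ : ρ ∈ Set.Ioo (0 : ℝ) 1) (d : ℕ) :
    ∀ (N : ℕ) (Y : ℕ → ℤ) (g : ℕ → ℤ → ℝ), d < N → (∀ m < d, Y m < Y (m + 1)) →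
      (∀ m < d, ∀ z, g m (z - 1) = (1 - ρ) * g m z + ρ * g (m + 1) z) →
      (∀ z, g d z = (1 - ρ) ^ (Y d - z)) → (∀ m < d, g m (Y m) = 0) →
      ∀ z ≤ Y 0, 0 ≤ g 0 z ∧
        (Measure.pi fun _ : Fin N => geomMeasure ρ) (firstPassage N Y z d) =
          ENNReal.ofReal (g 0 z) := by
  have hprob := isProbabilityMeasure_geomMeasure hρ
  have h1ρ : 0 < 1 - ρ := sub_pos.2 hρ.2
  induction d with
  | zero =>
    intro N Y g hN _ _ hg _ z hz
    obtain ⟨N, rfl⟩ : ∃ N', N = N' + 1 := ⟨N - 1, by omega⟩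
    obtain ⟨M, hM⟩ := Int.le.dest hz
    refine ⟨by rw [hg]; positivity, ?_⟩
    rw [pi_geomMeasure_succ hρ,
      ← Summable.sum_add_tsum_nat_add' (k := M) ENNReal.summable, hg,
      show Y 0 - z = (M : ℤ) by omega, zpow_natCast, ← tsum_ofReal_geometric_tail hρ M]
    simp only [cons_mem_firstPassage_zero]
    rw [Finset.sum_eq_zero, zero_add]
    · refine tsum_congr fun j => ?_
      have : Y 0 < z + ((j + M : ℕ) : ℤ) + 1 := by push_cast; omega
      simp only [this]
      simp
    · intro j hj
      have : ¬ Y 0 < z + (j : ℤ) + 1 := by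
        have := Finset.mem_range.1 hj
        omega
      simp [this]
  | succ d ih =>
    intro N Y g hN hY hrec hg hb z hz
    obtain ⟨N, rfl⟩ : ∃ N', N = N' + 1 := ⟨N - 1, by omega⟩
    obtain ⟨M, hM⟩ := Int.le.dest hz
    have ih' := ih N (fun m => Y (m + 1)) (fun m => g (m + 1)) (by omega)
      (fun m hm => hY (m + 1) (by omega)) (fun m hm => hrec (m + 1) (by omega)) hg
      (fun m hm => hb (m + 1) (by omega))
    have hY0 : Y 0 < Y 1 := hY 0 (by omega)
    have hle : ∀ j ∈ Finset.range M, z + (j : ℤ) + 1 ≤ Y 0 := fun j hj => by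
      have := Finset.mem_range.1 hj
      omega
    have hsum := sum_geometric_eq_of_recursion (hb 0 (by omega)) (hrec 0 (by omega)) M
    rw [show Y 0 - (M : ℤ) = z by omega] at hsum
    have hnn : ∀ j ∈ Finset.range M, 0 ≤ ρ * (1 - ρ) ^ j * g (0 + 1) (z + j + 1) := fun j hj =>
      mul_nonneg (mul_nonneg hρ.1.le (pow_nonneg h1ρ.le _))
        (ih' _ ((hle j hj).trans hY0.le)).1
    refine ⟨hsum ▸ Finset.sum_nonneg hnn, ?_⟩
    rw [pi_geomMeasure_succ hρ, hsum, ENNReal.ofReal_sum_of_nonneg hnn]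
    simp only [cons_mem_firstPassage_succ]
    rw [tsum_eq_sum (s := Finset.range M)]
    · refine Finset.sum_congr rfl fun j hj => ?_
      rw [ENNReal.ofReal_mul (mul_nonneg hρ.1.le (pow_nonneg h1ρ.le _)),
        ← (ih' _ ((hle j hj).trans hY0.le)).2]
      simp [hle j hj]
    · intro j hj
      have : ¬ z + (j : ℤ) + 1 ≤ Y 0 := by
        have := mt Finset.mem_range.2 hj
        omega
      simp [this]

lemma walkB_add (l n : ℕ) (z : ℤ) (ω : Fin (n - l) → ℕ) (m : ℕ) :
    walkB l n z ω (l + m) = geomWalk z ω m := by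
  simp [walkB, geomWalk, Finset.sum_filter]

lemma setOf_walkTau_eq {n k l : ℕ} (hlk : l ≤ k) (hk : k < n) (X₀ : ℕ → ℤ) (z : ℤ) :
    {ω | walkTau l n X₀ z ω = k} =
      firstPassage (n - l) (fun m => X₀ (n - (l + m))) z (k - l) := by
  ext ω
  obtain ⟨d, rfl⟩ := Nat.exists_eq_add_of_le hlk
  simp only [Set.mem_ofPred_eq, firstPassage, ← walkB_add, Nat.add_sub_cancel_left, walkTau]
  constructor
  · intro hτ
    constructor
    · intro m hm
      by_contra! hlt
      have := Nat.sInf_le (Set.mem_union_left {n} (show l + m ∈ {m : ℕ | l ≤ m ∧ m ≤ n - 1 ∧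
        X₀ (n - m) < walkB l n z ω m} from ⟨by omega, by omega, hlt⟩))
      omega
    · have hmem := Nat.sInf_mem (s := {m : ℕ | l ≤ m ∧ m ≤ n - 1 ∧
        X₀ (n - m) < walkB l n z ω m} ∪ {n}) ⟨n, Or.inr rfl⟩
      rw [hτ] at hmem
      rcases hmem with hmem | hmem
      · exact hmem.2.2
      · exact absurd hmem hk.ne
  · rintro ⟨h1, h2⟩
    refine IsLeast.csInf_eq ⟨Or.inl ⟨by omega, by omega, h2⟩, ?_⟩
    rintro m (⟨hm, -, hlt⟩ | rfl)
    · by_contra! hlt'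
      obtain ⟨e, rfl⟩ := Nat.exists_eq_add_of_le hm
      exact absurd hlt (h1 e (by omega)).not_gt
    · exact hk.le

theorem stmt10 (ρ : ℝ) (hρ : ρ ∈ Set.Ioo (0 : ℝ) 1) (n k l : ℕ) (hn : 1 ≤ n)
    (hlk : l ≤ k) (hk : k < n)
    (X₀ : ℕ → ℤ) (hX : ∀ i j : ℕ, 1 ≤ i → i < j → j ≤ n → X₀ j < X₀ i)
    (h : ℕ → ℤ → ℝ) (hh : SolvesIBVP ρ n k X₀ h)
    (z : ℤ) (hz : z ≤ X₀ (n - l)) :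
    (Measure.pi fun _ : Fin (n - l) => geomMeasure ρ)
        {ω | walkTau l n X₀ z ω = k}
      = ENNReal.ofReal (((1 - ρ) / ρ) * h l z) := by
  obtain ⟨hrec, hterm, hbd⟩ := hh
  have hρ0 : ρ ≠ 0 := hρ.1.ne'
  have h1ρ : 1 - ρ ≠ 0 := (sub_pos.2 hρ.2).ne'
  rw [setOf_walkTau_eq hlk hk]
  refine (pi_geomMeasure_firstPassage hρ (k - l) (n - l) (fun m => X₀ (n - (l + m)))
    (fun m z => (1 - ρ) / ρ * h (l + m) z) (by omega) (fun m hm => ?_) (fun m hm z => ?_)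
    (fun z => ?_) (fun m hm => ?_) z hz).2
  · exact hX _ _ (by omega) (by omega) (by omega)
  · have := hrec (l + m) (by omega) z
    simp only [← add_assoc]
    rw [← this]
    field_simp
    ring
  · simp only [Nat.add_sub_cancel' hlk]
    rw [hterm, zpow_sub_one₀ h1ρ]
    field_simp
  · simp [hbd (l + m) (by omega)]
end

section
/- For every ρ ∈ (0,1) and every real w with 0 < |w| < min(ρ, 1−ρ), the series Σ_{n=1}^∞ [2(−w)^{n−1}/(n(n+1)(n+2))]·(1/(ρ−1)^n − 1/ρ^n) converges absolutely and its sum equals (1/w³)·( w + (w+ρ−1)²·log(1 − w/(1−ρ)) − (ρ+w)²·log(1 + w/ρ) ). -/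
theorem hasSum_pow_div_three_consecutive {x : ℝ} (hx : x ≠ 0) (h : |x| < 1) :
    HasSum (fun m : ℕ => 2 * x ^ m / (((m : ℝ) + 1) * ((m : ℝ) + 2) * ((m : ℝ) + 3)))
      ((-(1 - x) ^ 2 * Real.log (1 - x) + 3 / 2 * x ^ 2 - x) / x ^ 3) := by
  have h1 := Real.hasSum_pow_div_log_of_abs_lt_one h
  have h2 := (hasSum_nat_add_iff' 1).2 h1
  have h3 := (hasSum_nat_add_iff' 2).2 h1
  convert ((h1.mul_left (1 / x)).sub (h2.mul_left (2 / x ^ 2))).add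
    (h3.mul_left (1 / x ^ 3)) using 1
  · rfl
  · funext m
    push_cast
    rw [show (m : ℝ) + 1 + 1 = m + 2 by ring, show (m : ℝ) + 2 + 1 = m + 3 by ring]
    have hm1 : (m : ℝ) + 1 ≠ 0 := by positivity
    have hm2 : (m : ℝ) + 2 ≠ 0 := by positivity
    have hm3 : (m : ℝ) + 3 ≠ 0 := by positivity
    field_simp
    ring
  · simp only [Finset.sum_range_succ, Finset.sum_range_zero]
    push_cast
    field_simp
    ring

theorem hasSum_neg_pow_div_three_consecutive {c w : ℝ} (hw0 : w ≠ 0) (h : |w| < |c|) :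
    HasSum (fun m : ℕ => 2 * (-w) ^ m / (((m : ℝ) + 1) * ((m : ℝ) + 2) * ((m : ℝ) + 3)) *
        (1 / c ^ (m + 1)))
      (1 / w ^ 3 * ((c + w) ^ 2 * Real.log (1 + w / c) - 3 / 2 * w ^ 2 - w * c)) := by
  have hc : c ≠ 0 := abs_pos.1 ((abs_nonneg w).trans_lt h)
  have hx : |-w / c| < 1 := by
    rwa [abs_div, abs_neg, div_lt_one (abs_pos.2 hc)]
  convert (hasSum_pow_div_three_consecutive (div_ne_zero (neg_ne_zero.2 hw0) hc) hx).mul_left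
    (1 / c) using 1
  · rfl
  · funext m
    rw [div_pow, pow_succ]
    field_simp
  · rw [show 1 - -w / c = 1 + w / c by ring]
    generalize Real.log (1 + w / c) = L
    field_simp
    ring

theorem stmt13 (ρ w : ℝ) (hρ : ρ ∈ Set.Ioo (0 : ℝ) 1) (hw0 : w ≠ 0)
    (hw : |w| < min ρ (1 - ρ)) :
    Summable (fun m : ℕ =>
      |2 * (-w) ^ m / (((m : ℝ) + 1) * ((m : ℝ) + 2) * ((m : ℝ) + 3)) *
        (1 / (ρ - 1) ^ (m + 1) - 1 / ρ ^ (m + 1))|) ∧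
    (∑' m : ℕ,
        2 * (-w) ^ m / (((m : ℝ) + 1) * ((m : ℝ) + 2) * ((m : ℝ) + 3)) *
          (1 / (ρ - 1) ^ (m + 1) - 1 / ρ ^ (m + 1)))
      = (1 / w ^ 3) *
          (w + (w + ρ - 1) ^ 2 * Real.log (1 - w / (1 - ρ)) -
            (ρ + w) ^ 2 * Real.log (1 + w / ρ)) := by
  obtain ⟨h0, h1⟩ := hρ
  obtain ⟨hwρ, hwρ'⟩ := lt_min_iff.1 hw
  have hA := hasSum_neg_pow_div_three_consecutive (c := ρ - 1) hw0
    (by rwa [abs_sub_comm, abs_of_pos (sub_pos.2 h1)])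
  have hB := hasSum_neg_pow_div_three_consecutive (c := ρ) hw0 (by rwa [abs_of_pos h0])
  have hS := hA.sub hB
  simp only [← mul_sub] at hS
  refine ⟨hS.summable.abs, hS.tsum_eq.trans ?_⟩
  rw [show 1 + w / (ρ - 1) = 1 - w / (1 - ρ) by rw [← neg_sub 1 ρ, div_neg, ← sub_eq_add_neg]]
  ring
end

section
/- For every ρ ∈ (0,1) and every real w with −ρ < w < 1−ρ and w ≠ 0, one has ν₁(w) − ν₂(w) < 0, where ν₁(w) := (1/w³)·( w + (w+ρ−1)² log(1 − w/(1−ρ)) − (ρ+w)² log(1 + w/ρ) ) and ν₂(w) := (2/w²)·( w + (ρ−1)(ρ−1+w) log(1 − w/(1−ρ)) − ρ(ρ+w) log(1 + w/ρ) ). -/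
/-- If `f z = 0` and, on `(v, z)`, the derivative `f'` stays negative once it is negative, then
positivity of `f` at `v` propagates to the whole interval `[v, z)`. -/
theorem pos_of_pos_left_of_deriv_neg_persistent {f f' : ℝ → ℝ} {v u z : ℝ} (hvu : v < u)
    (huz : u < z) (hc : ContinuousOn f (Set.Icc v z))
    (hd : ∀ x ∈ Set.Ioo v z, HasDerivAt f (f' x) x)
    (hn : ∀ p ∈ Set.Ioo v z, ∀ q ∈ Set.Ioo v z, p < q → f' p < 0 → f' q < 0)
    (hz : f z = 0) (hv : 0 < f v) : 0 < f u := by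
  by_contra! hu
  obtain ⟨p, hp, hpe⟩ := exists_hasDerivAt_eq_slope f f' hvu
    (hc.mono (Set.Icc_subset_Icc_right huz.le)) fun x hx => hd x ⟨hx.1, hx.2.trans huz⟩
  obtain ⟨q, hq, hqe⟩ := exists_hasDerivAt_eq_slope f f' huz
    (hc.mono (Set.Icc_subset_Icc_left hvu.le)) fun x hx => hd x ⟨hvu.trans hx.1, hx.2⟩
  have h1 : f' p < 0 := by
    rw [hpe]
    exact div_neg_of_neg_of_pos (by linarith) (by linarith)
  have h2 := hn p ⟨hp.1, hp.2.trans huz⟩ q ⟨hvu.trans hq.1, hq.2⟩ (hp.2.trans hq.1) h1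
  rw [hqe, hz] at h2
  exact absurd h2 (not_lt.2 (div_nonneg (by linarith) (by linarith)))

theorem neg_of_deriv_neg {f f' : ℝ → ℝ} {z : ℝ}
    (hd : ∀ x ∈ Set.Ico 0 z, HasDerivAt f (f' x) x) (hn : ∀ x ∈ Set.Ioo 0 z, f' x < 0)
    (h0 : f 0 = 0) : ∀ x ∈ Set.Ioo 0 z, f x < 0 := by
  intro x hx
  obtain ⟨p, hp, hpe⟩ := exists_hasDerivAt_eq_slope f f' hx.1
    (fun y hy => (hd y ⟨hy.1, hy.2.trans_lt hx.2⟩).continuousAt.continuousWithinAt)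
    fun y hy => hd y ⟨hy.1.le, hy.2.trans hx.2⟩
  have h1 := hn p ⟨hp.1, hp.2.trans hx.2⟩
  rw [hpe, h0, sub_zero, sub_zero] at h1
  by_contra! h
  exact absurd h1 (not_lt.2 (div_nonneg h hx.1.le))

/-- `w ^ 3 * (ν₁ w - ν₂ w)`, cleared of denominators. -/
noncomputable def nuGap (ρ w : ℝ) : ℝ :=
  w - 2 * w ^ 2 + (1 - ρ - w) * (1 - ρ - w - 2 * w * (1 - ρ)) * Real.log (1 - w / (1 - ρ)) -
    (ρ + w) * (ρ + w - 2 * w * ρ) * Real.log (1 + w / ρ)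

noncomputable def nuGapDeriv (ρ w : ℝ) : ℝ :=
  -2 * w + (-2 * (1 - ρ) - 2 * (1 - ρ) ^ 2 + 2 * w * (3 - 2 * ρ)) * Real.log (1 - w / (1 - ρ)) -
    (2 * ρ - 2 * ρ ^ 2 + 2 * w * (1 - 2 * ρ)) * Real.log (1 + w / ρ)

noncomputable def nuGapDeriv2 (ρ w : ℝ) : ℝ :=
  2 - 2 * (1 - ρ) ^ 2 / (1 - ρ - w) - 2 * ρ ^ 2 / (ρ + w) +
    2 * (3 - 2 * ρ) * Real.log (1 - w / (1 - ρ)) - 2 * (1 - 2 * ρ) * Real.log (1 + w / ρ)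

noncomputable def nuGapDeriv3 (ρ w : ℝ) : ℝ :=
  -(2 * (1 - ρ) ^ 2 / (1 - ρ - w) ^ 2) + 2 * ρ ^ 2 / (ρ + w) ^ 2 -
    2 * (3 - 2 * ρ) / (1 - ρ - w) - 2 * (1 - 2 * ρ) / (ρ + w)

section

variable {ρ w : ℝ}

theorem hasDerivAt_log_one_sub_div (h1 : ρ < 1) (hw : w < 1 - ρ) :
    HasDerivAt (fun w => Real.log (1 - w / (1 - ρ))) (-1 / (1 - ρ - w)) w := by
  have ha : 1 - ρ ≠ 0 := by linarith
  have hy : 1 - ρ - w ≠ 0 := by linarith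
  have e : 1 - w / (1 - ρ) = (1 - ρ - w) / (1 - ρ) := by field_simp
  have hne : 1 - w / (1 - ρ) ≠ 0 := by rw [e]; exact div_ne_zero hy ha
  convert (((hasDerivAt_id' w).div_const (1 - ρ)).const_sub 1).log hne using 1
  rw [e]
  field_simp

theorem hasDerivAt_log_one_add_div (h0 : 0 < ρ) (hw : -ρ < w) :
    HasDerivAt (fun w => Real.log (1 + w / ρ)) (1 / (ρ + w)) w := by
  have hx : ρ + w ≠ 0 := by linarith
  have e : 1 + w / ρ = (ρ + w) / ρ := by field_simp
  have hne : 1 + w / ρ ≠ 0 := by rw [e]; exact div_ne_zero hx h0.ne'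
  convert (((hasDerivAt_id' w).div_const ρ).const_add 1).log hne using 1
  rw [e]
  field_simp

theorem hasDerivAt_nuGap (h0 : 0 < ρ) (h1 : ρ < 1) (hw1 : -ρ < w) (hw2 : w < 1 - ρ) :
    HasDerivAt (nuGap ρ) (nuGapDeriv ρ w) w := by
  have hy : 1 - ρ - w ≠ 0 := by linarith
  have hx : ρ + w ≠ 0 := by linarith
  have hi := hasDerivAt_id' w
  have h := ((hi.sub ((hi.pow 2).const_mul 2)).add
    (((hi.const_sub (1 - ρ)).mul
      ((hi.const_sub (1 - ρ)).sub ((hi.const_mul 2).mul_const (1 - ρ)))).mul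
        (hasDerivAt_log_one_sub_div h1 hw2))).sub
    (((hi.const_add ρ).mul ((hi.const_add ρ).sub ((hi.const_mul 2).mul_const ρ))).mul
        (hasDerivAt_log_one_add_div h0 hw1))
  refine h.congr_deriv ?_
  simp only [nuGapDeriv, Pi.mul_apply, Pi.sub_apply]
  field_simp
  ring

theorem hasDerivAt_nuGapDeriv (h0 : 0 < ρ) (h1 : ρ < 1) (hw1 : -ρ < w) (hw2 : w < 1 - ρ) :
    HasDerivAt (nuGapDeriv ρ) (nuGapDeriv2 ρ w) w := by
  have hy : 1 - ρ - w ≠ 0 := by linarith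
  have hx : ρ + w ≠ 0 := by linarith
  have hi := hasDerivAt_id' w
  have h := ((hi.const_mul (-2)).add
    ((((hi.const_mul 2).mul_const (3 - 2 * ρ)).const_add
      (-2 * (1 - ρ) - 2 * (1 - ρ) ^ 2)).mul (hasDerivAt_log_one_sub_div h1 hw2))).sub
    ((((hi.const_mul 2).mul_const (1 - 2 * ρ)).const_add (2 * ρ - 2 * ρ ^ 2)).mul
        (hasDerivAt_log_one_add_div h0 hw1))
  refine h.congr_deriv ?_
  simp only [nuGapDeriv2]
  field_simp
  ring

theorem hasDerivAt_nuGapDeriv2 (h0 : 0 < ρ) (h1 : ρ < 1) (hw1 : -ρ < w) (hw2 : w < 1 - ρ) :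
    HasDerivAt (nuGapDeriv2 ρ) (nuGapDeriv3 ρ w) w := by
  have hy : 1 - ρ - w ≠ 0 := by linarith
  have hx : ρ + w ≠ 0 := by linarith
  have hi := hasDerivAt_id' w
  have h := (((((hasDerivAt_const w (2 * (1 - ρ) ^ 2)).div (hi.const_sub (1 - ρ)) hy).const_sub
    2).sub ((hasDerivAt_const w (2 * ρ ^ 2)).div (hi.const_add ρ) hx)).add
    ((hasDerivAt_log_one_sub_div h1 hw2).const_mul (2 * (3 - 2 * ρ)))).sub
    ((hasDerivAt_log_one_add_div h0 hw1).const_mul (2 * (1 - 2 * ρ)))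
  refine h.congr_deriv ?_
  simp only [nuGapDeriv3]
  field_simp
  ring

theorem nuGap_zero (ρ : ℝ) : nuGap ρ 0 = 0 := by simp [nuGap]

theorem nuGapDeriv_zero (ρ : ℝ) : nuGapDeriv ρ 0 = 0 := by simp [nuGapDeriv]

theorem nuGapDeriv2_zero (h1 : ρ < 1) : nuGapDeriv2 ρ 0 = 0 := by
  have ha : 1 - ρ ≠ 0 := by linarith
  simp only [nuGapDeriv2, sub_zero, add_zero, zero_div, Real.log_one, mul_zero]
  field_simp
  ring

theorem continuous_nuGap_right_term (h0 : 0 < ρ) :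
    Continuous fun w => (ρ + w) * (ρ + w - 2 * w * ρ) * Real.log (1 + w / ρ) := by
  have h : Continuous fun w : ℝ =>
      ρ * (ρ + w - 2 * w * ρ) * ((1 + w / ρ) * Real.log (1 + w / ρ)) :=
    (by fun_prop : Continuous fun w : ℝ => ρ * (ρ + w - 2 * w * ρ)).mul
      (Real.continuous_mul_log.comp (by fun_prop : Continuous fun w : ℝ => 1 + w / ρ))
  convert h using 2
  field_simp

theorem continuousOn_nuGap (h0 : 0 < ρ) (h1 : ρ < 1) :
    ContinuousOn (nuGap ρ) (Set.Icc (-ρ) 0) := by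
  have hL : ContinuousOn (fun w => Real.log (1 - w / (1 - ρ))) (Set.Icc (-ρ) 0) := fun w hw =>
    (hasDerivAt_log_one_sub_div h1 (by linarith [hw.2])).continuousAt.continuousWithinAt
  unfold nuGap
  exact ((by fun_prop : Continuous fun w : ℝ => w - 2 * w ^ 2).continuousOn.add
    ((by fun_prop : Continuous fun w : ℝ =>
      (1 - ρ - w) * (1 - ρ - w - 2 * w * (1 - ρ))).continuousOn.mul hL)).sub
    (continuous_nuGap_right_term h0).continuousOn

theorem nuGapDeriv3_neg_of_pos (h0 : 0 < ρ) (h1 : ρ < 1) (hw0 : 0 < w) (hw : w < 1 - ρ) :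
    nuGapDeriv3 ρ w < 0 := by
  have hy : 0 < 1 - ρ - w := by linarith
  have hx : 0 < ρ + w := by linarith
  have e1 : 1 < (1 - ρ) ^ 2 / (1 - ρ - w) ^ 2 := by
    rw [one_lt_div (by positivity)]
    nlinarith
  have e2 : ρ ^ 2 / (ρ + w) ^ 2 < 1 := by
    rw [div_lt_one (by positivity)]
    nlinarith
  have e3 : 0 < (3 - 2 * ρ) / (1 - ρ - w) + (1 - 2 * ρ) / (ρ + w) := by
    rw [div_add_div _ _ hy.ne' hx.ne']
    apply div_pos _ (by positivity)
    nlinarith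
  simp only [nuGapDeriv3, mul_div_assoc] at *
  linarith

theorem nuGapDeriv3_neg_persistent (h0 : 0 < ρ) (h1 : ρ < 1) {p q : ℝ} (hp : -ρ < p)
    (hpq : p < q) (hq : q < 0) (h : nuGapDeriv3 ρ p < 0) : nuGapDeriv3 ρ q < 0 := by
  have hyq : 0 < 1 - ρ - q := by linarith
  have hyp : 0 < 1 - ρ - p := by linarith
  have hxp : 0 < ρ + p := by linarith
  have hxq : 0 < ρ + q := by linarith
  have ha : 0 < 3 - 2 * ρ := by linarith
  have e1 : 2 * (1 - ρ) ^ 2 / (1 - ρ - p) ^ 2 ≤ 2 * (1 - ρ) ^ 2 / (1 - ρ - q) ^ 2 := by gcongr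
  have e2 : 2 * (3 - 2 * ρ) / (1 - ρ - p) ≤ 2 * (3 - 2 * ρ) / (1 - ρ - q) := by gcongr
  have f1 : 0 < 2 * (1 - ρ) ^ 2 / (1 - ρ - p) ^ 2 := by
    have : 0 < 1 - ρ := by linarith
    positivity
  have f2 : 0 < 2 * (3 - 2 * ρ) / (1 - ρ - p) := by positivity
  simp only [nuGapDeriv3] at *
  rcases le_total (1 - 2 * ρ) 0 with hs | hs
  · have e3 : 2 * ρ ^ 2 / (ρ + q) ^ 2 ≤ 2 * ρ ^ 2 / (ρ + p) ^ 2 := by gcongr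
    have e4 : 2 * (2 * ρ - 1) / (ρ + q) ≤ 2 * (2 * ρ - 1) / (ρ + p) := by
      have : 0 ≤ 2 * ρ - 1 := by linarith
      gcongr
    have e5 : ∀ x, 2 * (2 * ρ - 1) / x = -(2 * (1 - 2 * ρ) / x) := fun x => by ring
    rw [e5, e5] at e4
    linarith
  · set A := 2 * (1 - ρ) ^ 2 / (1 - ρ - p) ^ 2
    set B := 2 * (3 - 2 * ρ) / (1 - ρ - p)
    set C := 2 * (1 - ρ) ^ 2 / (1 - ρ - q) ^ 2
    set D := 2 * (3 - 2 * ρ) / (1 - ρ - q)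
    have key : ∀ x, 0 < x → ∀ S T : ℝ, -S + 2 * ρ ^ 2 / x ^ 2 - T - 2 * (1 - 2 * ρ) / x =
        (2 * ρ ^ 2 - 2 * (1 - 2 * ρ) * x - (S + T) * x ^ 2) / x ^ 2 := by
      intro x hx S T
      field_simp
      ring
    rw [key _ hxp, div_lt_iff₀ (by positivity), zero_mul] at h
    rw [key _ hxq, div_lt_iff₀ (by positivity), zero_mul]
    have g1 : (A + B) * (ρ + p) ^ 2 ≤ (C + D) * (ρ + q) ^ 2 := by gcongr
    have g2 : 2 * (1 - 2 * ρ) * (ρ + p) ≤ 2 * (1 - 2 * ρ) * (ρ + q) := by gcongr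
    linarith

theorem nuGap_neg_of_pos (h0 : 0 < ρ) (h1 : ρ < 1) (hw0 : 0 < w) (hw : w < 1 - ρ) :
    nuGap ρ w < 0 :=
  neg_of_deriv_neg (fun _ hx => hasDerivAt_nuGap h0 h1 (by linarith [hx.1]) hx.2)
    (neg_of_deriv_neg (fun _ hx => hasDerivAt_nuGapDeriv h0 h1 (by linarith [hx.1]) hx.2)
      (neg_of_deriv_neg (fun _ hx => hasDerivAt_nuGapDeriv2 h0 h1 (by linarith [hx.1]) hx.2)
        (fun _ hx => nuGapDeriv3_neg_of_pos h0 h1 hx.1 hx.2) (nuGapDeriv2_zero h1))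
      (nuGapDeriv_zero ρ)) (nuGap_zero ρ) w ⟨hw0, hw⟩

end

theorem hasDerivAt_neg_log_one_sub_sub {b : ℝ} (h0 : 0 ≤ b) (h1 : b < 1) :
    HasDerivAt (fun b : ℝ => -Real.log (1 - b) - (b + 2 * b ^ 2) / (1 + 2 * b - 2 * b ^ 2))
      (b * (1 - 2 * b) * (1 - 2 * b ^ 2) / ((1 - b) * (1 + 2 * b - 2 * b ^ 2) ^ 2)) b := by
  have hb : 1 - b ≠ 0 := by linarith
  have hD : 1 + 2 * b - 2 * b ^ 2 ≠ 0 := by nlinarith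
  have hi := hasDerivAt_id' b
  have h := ((hi.const_sub 1).log hb).neg.sub ((hi.add ((hi.pow 2).const_mul 2)).div
    (((hi.const_mul 2).const_add 1).sub ((hi.pow 2).const_mul 2)) hD)
  refine h.congr_deriv ?_
  simp only [Pi.add_apply, Pi.sub_apply, Pi.pow_apply]
  generalize hDe : 1 + 2 * b - 2 * b ^ 2 = D at hD ⊢
  field_simp
  rw [← hDe]
  ring

theorem neg_log_one_sub_gt_at_inv_sqrt_two {c : ℝ} (h0 : 0 < c) (hc : c ^ 2 = 1 / 2) :
    0 < -Real.log (1 - c) - (c + 2 * c ^ 2) / (1 + 2 * c - 2 * c ^ 2) := by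
  have hl : 0.7071 < c := by nlinarith
  have hu : c < 0.7072 := by nlinarith
  have e1 : (c + 2 * c ^ 2) / (1 + 2 * c - 2 * c ^ 2) = c + 1 / 2 := by
    rw [hc]
    field_simp
    nlinarith
  have e2 : 1 - c = (2 + 2 * c)⁻¹ := by
    field_simp
    nlinarith
  rw [e1, e2, Real.log_inv, neg_neg, sub_pos, Real.lt_log_iff_exp_lt (by positivity)]
  have hs : Real.exp 0.1036 ≤ 1 / 0.8964 := by
    have h := Real.add_one_le_exp (-0.1036 : ℝ)
    rw [Real.exp_neg] at h
    rw [le_div_iff₀ (by norm_num)]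
    have hp := Real.exp_pos (0.1036 : ℝ)
    have := mul_le_mul_of_nonneg_left h hp.le
    rw [mul_inv_cancel₀ hp.ne'] at this
    linarith
  calc Real.exp (c + 1 / 2) ≤ Real.exp (1 + 0.1036 + 0.1036) := Real.exp_le_exp.2 (by linarith)
    _ = Real.exp 1 * Real.exp 0.1036 * Real.exp 0.1036 := by rw [Real.exp_add, Real.exp_add]
    _ ≤ 2.7182818286 * (1 / 0.8964) * (1 / 0.8964) := by
      have := Real.exp_one_lt_d9.le
      gcongr
    _ < 2 + 2 * c := by norm_num at *; linarith

theorem neg_log_one_sub_gt {b : ℝ} (h0 : 0 < b) (h1 : b < 1) :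
    0 < -Real.log (1 - b) - (b + 2 * b ^ 2) / (1 + 2 * b - 2 * b ^ 2) := by
  set F : ℝ → ℝ := fun b => -Real.log (1 - b) - (b + 2 * b ^ 2) / (1 + 2 * b - 2 * b ^ 2) with hF
  change 0 < F b
  have hd : ∀ x : ℝ, 0 ≤ x → x < 1 → HasDerivAt F _ x :=
    fun x => hasDerivAt_neg_log_one_sub_sub
  have hcont : ∀ u v : ℝ, 0 ≤ u → v < 1 → ContinuousOn F (Set.Icc u v) := fun u v hu hv x hx =>
    (hd x (hu.trans hx.1) (hx.2.trans_lt hv)).continuousAt.continuousWithinAt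
  have hden : ∀ x : ℝ, 0 < x → x < 1 → 0 < (1 - x) * (1 + 2 * x - 2 * x ^ 2) ^ 2 :=
    fun x hx0 hx1 => mul_pos (by linarith) (pow_pos (by nlinarith) 2)
  have hc0 : 0 < √(1 / 2 : ℝ) := by positivity
  have hcs : √(1 / 2 : ℝ) ^ 2 = 1 / 2 := Real.sq_sqrt (by norm_num)
  set c := √(1 / 2 : ℝ)
  have hc1 : c < 1 := by nlinarith
  have hFc : 0 < F c := neg_log_one_sub_gt_at_inv_sqrt_two hc0 hcs
  rcases le_or_gt b (1 / 2) with hb | hb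
  · obtain ⟨x, hx, hxe⟩ := exists_hasDerivAt_eq_slope F _ h0 (hcont 0 b le_rfl h1)
      fun x hx => hd x hx.1.le (hx.2.trans h1)
    have hpos : 0 < (F b - F 0) / (b - 0) := by
      rw [← hxe]
      have h2 : 0 < 1 - 2 * x := by linarith [hx.2]
      have h3 : 0 < 1 - 2 * x ^ 2 := by nlinarith [hx.1, hx.2]
      exact div_pos (mul_pos (mul_pos hx.1 h2) h3) (hden x hx.1 (hx.2.trans h1))
    have hF0 : F 0 = 0 := by simp [hF]
    rw [hF0, sub_zero, sub_zero] at hpos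
    exact (div_pos_iff_of_pos_right h0).1 hpos
  rcases lt_trichotomy b c with hbc | rfl | hbc
  · obtain ⟨x, hx, hxe⟩ := exists_hasDerivAt_eq_slope F _ hbc (hcont b c h0.le hc1)
      fun x hx => hd x (h0.trans hx.1).le (hx.2.trans hc1)
    have hneg : (F c - F b) / (c - b) ≤ 0 := by
      rw [← hxe]
      have hx0 : 0 < x := h0.trans hx.1
      have h2 : 1 - 2 * x ≤ 0 := by linarith [hx.1]
      have h3 : 0 ≤ 1 - 2 * x ^ 2 := by nlinarith [hx.2]
      exact div_nonpos_of_nonpos_of_nonneg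
        (mul_nonpos_of_nonpos_of_nonneg (mul_nonpos_of_nonneg_of_nonpos hx0.le h2) h3)
        (hden x hx0 (hx.2.trans hc1)).le
    rw [div_le_iff₀ (by linarith), zero_mul] at hneg
    linarith
  · exact hFc
  · obtain ⟨x, hx, hxe⟩ := exists_hasDerivAt_eq_slope F _ hbc (hcont c b hc0.le h1)
      fun x hx => hd x (hc0.trans hx.1).le (hx.2.trans h1)
    have hpos : 0 ≤ (F b - F c) / (b - c) := by
      rw [← hxe]
      have hx0 : 0 < x := hc0.trans hx.1
      have h2 : 1 - 2 * x ≤ 0 := by nlinarith [hx.1]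
      have h3 : 1 - 2 * x ^ 2 ≤ 0 := by nlinarith [hx.1]
      exact div_nonneg (mul_nonneg_of_nonpos_of_nonpos
        (mul_nonpos_of_nonneg_of_nonpos hx0.le h2) h3) (hden x hx0 (hx.2.trans h1)).le
    rw [le_div_iff₀ (by linarith), zero_mul] at hpos
    linarith

theorem nuGap_neg_self_pos {ρ : ℝ} (h0 : 0 < ρ) (h1 : ρ < 1) : 0 < nuGap ρ (-ρ) := by
  have ha : 0 < 1 - ρ := by linarith
  have hD : 0 < 1 + 2 * ρ - 2 * ρ ^ 2 := by nlinarith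
  have h := neg_log_one_sub_gt h0 h1
  have e : 1 - -ρ / (1 - ρ) = (1 - ρ)⁻¹ := by
    field_simp
    ring
  rw [sub_pos, div_lt_iff₀ hD] at h
  rw [nuGap, e, Real.log_inv]
  linear_combination h

theorem nuGap_pos_of_neg {ρ w : ℝ} (h0 : 0 < ρ) (h1 : ρ < 1) (hw1 : -ρ < w) (hw0 : w < 0) :
    0 < nuGap ρ w := by
  have hlt : ∀ {x : ℝ}, x ≤ 0 → x < 1 - ρ := fun hx => by linarith
  have hN2 : ∀ v u, -ρ < v → v < u → u < 0 → 0 < nuGapDeriv2 ρ v → 0 < nuGapDeriv2 ρ u :=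
    fun v u hv hvu hu => pos_of_pos_left_of_deriv_neg_persistent hvu hu
      (fun x hx => (hasDerivAt_nuGapDeriv2 h0 h1 (hv.trans_le hx.1)
        (hlt hx.2)).continuousAt.continuousWithinAt)
      (fun x hx => hasDerivAt_nuGapDeriv2 h0 h1 (hv.trans hx.1) (hlt hx.2.le))
      (fun p hp q hq hpq => nuGapDeriv3_neg_persistent h0 h1 (hv.trans hp.1) hpq hq.2)
      (nuGapDeriv2_zero h1)
  have hN1 : ∀ v u, -ρ < v → v < u → u < 0 → 0 < -nuGapDeriv ρ v → 0 < -nuGapDeriv ρ u :=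
    fun v u hv hvu hu => pos_of_pos_left_of_deriv_neg_persistent
      (f := fun x => -nuGapDeriv ρ x) (f' := fun x => -nuGapDeriv2 ρ x) hvu hu
      (fun x hx => (hasDerivAt_nuGapDeriv h0 h1 (hv.trans_le hx.1)
        (hlt hx.2)).neg.continuousAt.continuousWithinAt)
      (fun x hx => (hasDerivAt_nuGapDeriv h0 h1 (hv.trans hx.1) (hlt hx.2.le)).neg)
      (fun p hp q hq hpq h => neg_lt_zero.2
        (hN2 p q (hv.trans hp.1) hpq hq.2 (neg_lt_zero.1 h)))
      (by simp [nuGapDeriv_zero])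
  exact pos_of_pos_left_of_deriv_neg_persistent hw1 hw0 (continuousOn_nuGap h0 h1)
    (fun x hx => hasDerivAt_nuGap h0 h1 hx.1 (hlt hx.2.le))
    (fun p hp q hq hpq h => neg_pos.1 (hN1 p q hp.1 hpq hq.2 (neg_pos.2 h)))
    (nuGap_zero ρ) (nuGap_neg_self_pos h0 h1)

theorem stmt14 (ρ w : ℝ) (hρ : ρ ∈ Set.Ioo (0 : ℝ) 1) (hw1 : -ρ < w) (hw2 : w < 1 - ρ)
    (hw0 : w ≠ 0) :
    (1 / w ^ 3) *
        (w + (w + ρ - 1) ^ 2 * Real.log (1 - w / (1 - ρ)) -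
          (ρ + w) ^ 2 * Real.log (1 + w / ρ)) -
      (2 / w ^ 2) *
        (w + (ρ - 1) * (ρ - 1 + w) * Real.log (1 - w / (1 - ρ)) -
          ρ * (ρ + w) * Real.log (1 + w / ρ)) < 0 := by
  obtain ⟨h0, h1⟩ := hρ
  have e : (1 / w ^ 3) *
        (w + (w + ρ - 1) ^ 2 * Real.log (1 - w / (1 - ρ)) -
          (ρ + w) ^ 2 * Real.log (1 + w / ρ)) -
      (2 / w ^ 2) *
        (w + (ρ - 1) * (ρ - 1 + w) * Real.log (1 - w / (1 - ρ)) -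
          ρ * (ρ + w) * Real.log (1 + w / ρ)) = nuGap ρ w / w ^ 3 := by
    generalize hL : Real.log (1 - w / (1 - ρ)) = L
    generalize hM : Real.log (1 + w / ρ) = M
    rw [nuGap, hL, hM]
    field_simp
    ring
  rw [e]
  rcases hw0.lt_or_gt with h | h
  · exact div_neg_of_pos_of_neg (nuGap_pos_of_neg h0 h1 hw1 h) (Odd.pow_neg (by decide) h)
  · exact div_neg_of_neg_of_pos (nuGap_neg_of_pos h0 h1 h hw2) (pow_pos h 3)
end

section
/- For every ρ ∈ (0,1) and every θ ∈ ℝ, the quantity (1+(1−ρ)²)/ρ² + (2(1−ρ)/ρ)·cos θ is strictly positive, and −2(1−ρ) − 2(1−ρ)cos θ + ρ²·log( (1+(1−ρ)²)/ρ² + (2(1−ρ)/ρ)·cos θ ) ≤ −2(1−ρ)²·cos θ. -/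
theorem stmt17 (ρ : ℝ) (hρ : ρ ∈ Set.Ioo (0 : ℝ) 1) (θ : ℝ) :
    0 < (1 + (1 - ρ) ^ 2) / ρ ^ 2 + (2 * (1 - ρ) / ρ) * Real.cos θ ∧
    -2 * (1 - ρ) - 2 * (1 - ρ) * Real.cos θ +
        ρ ^ 2 * Real.log ((1 + (1 - ρ) ^ 2) / ρ ^ 2 + (2 * (1 - ρ) / ρ) * Real.cos θ)
      ≤ -2 * (1 - ρ) ^ 2 * Real.cos θ := by
  obtain ⟨h0, h1⟩ := hρ
  have hne : ρ ≠ 0 := h0.ne'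
  set c := Real.cos θ with hc
  have hc1 : -1 ≤ c := Real.neg_one_le_cos θ
  have hX : (1 + (1 - ρ) ^ 2) / ρ ^ 2 + (2 * (1 - ρ) / ρ) * c
      = 1 + 2 * (1 - ρ) * (1 + ρ * c) / ρ ^ 2 := by
    field_simp
    ring
  rw [hX]
  have hq : 0 < 1 - ρ := by linarith
  have hs : 0 < 1 + ρ * c := by nlinarith
  have hpos : 0 < 1 + 2 * (1 - ρ) * (1 + ρ * c) / ρ ^ 2 := by positivity
  refine ⟨hpos, ?_⟩
  have hlog := mul_le_mul_of_nonneg_left (Real.log_le_sub_one_of_pos hpos) (sq_nonneg ρ)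
  have hY : ρ ^ 2 * (1 + 2 * (1 - ρ) * (1 + ρ * c) / ρ ^ 2 - 1)
      = 2 * (1 - ρ) * (1 + ρ * c) := by
    field_simp
    ring
  rw [hY] at hlog
  linarith
end
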